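/- Let m, n ∈ ℕ, let u ∈ W^{m,1}_loc(ℝⁿ), and let all derivatives D^α u for |α| ≤ m be defined at every point x ∈ ℝⁿ by D^α u(x) = limsup_{r→0} of the average of D^α u over B(x,r). Then there is a constant C depending only on n and m such that for all x, y ∈ ℝⁿ with x ≠ y, max over multi-indices α with |α| ≤ m−1 of |D^α u(y) − T_x^{m−1−|α|}D^α u(y)| / |x − y|^{m−|α|} is at most C (ℳ|∇^m u|(x) + ℳ|∇^m u|(y)), where T_x^{k}D^α u(y) = Σ_{|β|≤k} D^{α+β} u(x) (y−x)^β/β! and ℳ is the Hardy–Littlewood maximal function. -/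

import Mathlib

open MeasureTheory Metric Set Filter
open scoped ENNReal

/-- `g` is the weak `i`-th partial derivative of `f` on `ℝⁿ`. -/
def HasWeakPartialDeriv {n : ℕ} (f g : EuclideanSpace ℝ (Fin n) → ℝ) (i : Fin n) : Prop :=
  ∀ φ : EuclideanSpace ℝ (Fin n) → ℝ, ContDiff ℝ (⊤ : ℕ∞) φ → HasCompactSupport φ →
    ∫ x, f x * fderiv ℝ φ x (EuclideanSpace.single i 1) = - ∫ x, g x * φ x

/-- `D` is a family of weak partial derivatives of `u`, indexed by multi-indices
`α : Fin n → ℕ`, compatible up to order `m`. -/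
def WeakDerivFamily {n : ℕ} (m : ℕ) (u : EuclideanSpace ℝ (Fin n) → ℝ)
    (D : (Fin n → ℕ) → EuclideanSpace ℝ (Fin n) → ℝ) : Prop :=
  D 0 = u ∧
  ∀ (α : Fin n → ℕ) (i : Fin n), (∑ j, α j) < m →
    HasWeakPartialDeriv (D α) (D (α + Pi.single i 1)) i

/-- The precise representative `x ↦ limsup_{r → 0⁺} ⨍_{B(x,r)} f`. -/
noncomputable def rep {n : ℕ} (f : EuclideanSpace ℝ (Fin n) → ℝ)
    (x : EuclideanSpace ℝ (Fin n)) : ℝ :=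
  Filter.limsup (fun r : ℝ => ⨍ y in ball x r, f y) (nhdsWithin 0 (Set.Ioi 0))

/-- The Hardy–Littlewood maximal function, with values in `ℝ≥0∞`. -/
noncomputable def maxFn {n : ℕ} (g : EuclideanSpace ℝ (Fin n) → ℝ)
    (x : EuclideanSpace ℝ (Fin n)) : ℝ≥0∞ :=
  ⨆ (r : ℝ) (_ : 0 < r), (volume (ball x r))⁻¹ * ∫⁻ y in ball x r, ‖g y‖₊

/-- `|∇^m u|`: the Euclidean norm of the vector of all `m`-th order weak partial
derivatives from the family `D`. -/
noncomputable def gradmNorm {n : ℕ} (m : ℕ)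
    (D : (Fin n → ℕ) → EuclideanSpace ℝ (Fin n) → ℝ)
    (x : EuclideanSpace ℝ (Fin n)) : ℝ :=
  Real.sqrt (∑' α : {α : Fin n → ℕ // (∑ j, α j) = m}, (D α.1 x) ^ 2)

lemma norm_add_smul_le_of_mem_Ioc {E : Type*} [NormedAddCommGroup E] [NormedSpace ℝ E]
    {z h : E} {t R : ℝ} (ht : t ∈ Set.Ioc (0 : ℝ) 1)
    (hz : ‖z‖ ≤ R) : ‖z + t • h‖ ≤ R + ‖h‖ := by
  refine (norm_add_le _ _).trans (add_le_add hz ?_)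
  rw [norm_smul, Real.norm_of_nonneg ht.1.le]
  exact mul_le_of_le_one_left (norm_nonneg _) ht.2

section Translation

variable {E : Type*} [NormedAddCommGroup E] [NormedSpace ℝ E] [FiniteDimensional ℝ E]
  [MeasurableSpace E] [BorelSpace E] {μ : Measure E} [μ.IsAddHaarMeasure]

lemma integrable_comp_add_smul {G : E → ℝ} (hGm : Measurable G) (hG : Integrable G μ) (h : E) :
    Integrable (fun p : E × ℝ => G (p.1 + p.2 • h))
      (μ.prod (volume.restrict (Set.Ioc (0 : ℝ) 1))) := by
  have hm : Measurable (fun p : E × ℝ => G (p.1 + p.2 • h)) := by fun_prop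
  refine ⟨hm.aestronglyMeasurable, ?_⟩
  rw [HasFiniteIntegral, lintegral_prod_symm' _ hm.enorm]
  have : ∀ t : ℝ, ∫⁻ x, ‖G (x + t • h)‖ₑ ∂μ = ∫⁻ x, ‖G x‖ₑ ∂μ := fun t =>
    lintegral_add_right_eq_self (μ := μ) (fun x => ‖G x‖ₑ) (t • h)
  simp only [this, lintegral_const]
  exact ENNReal.mul_lt_top hG.2 (measure_lt_top _ _)

lemma locallyIntegrable_integral_comp_add_smul {G : E → ℝ} (hGm : Measurable G)
    (hG : LocallyIntegrable G μ) (h : E) :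
    LocallyIntegrable (fun z => ∫ t, G (z + t • h) ∂(volume.restrict (Set.Ioc (0 : ℝ) 1))) μ := by
  rw [locallyIntegrable_iff]
  intro K hK
  obtain ⟨R, hR⟩ := hK.isBounded.exists_norm_le
  set G₁ := (closedBall (0 : E) (R + ‖h‖)).indicator G
  have hG₁ : Integrable G₁ μ :=
    (hG.integrableOn_isCompact (isCompact_closedBall _ _)).integrable_indicator
      measurableSet_closedBall
  have hi := (integrable_comp_add_smul (hGm.indicator measurableSet_closedBall) hG₁ h).integral_prod_left
  refine hi.integrableOn.congr_fun ?_ hK.measurableSet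
  intro z hz
  refine setIntegral_congr_fun measurableSet_Ioc fun t ht => ?_
  have : z + t • h ∈ closedBall (0 : E) (R + ‖h‖) := by
    simpa using norm_add_smul_le_of_mem_Ioc (h := h) ht (hR z hz)
  simp [Set.indicator_of_mem this]

/-- The fundamental theorem of calculus along almost every segment in direction `h`,
for a weakly differentiable function. -/
lemma ae_sub_eq_integral_of_weak_lineDeriv {f G : E → ℝ} (hf : LocallyIntegrable f μ)
    (hGm : Measurable G) (hG : LocallyIntegrable G μ) (h : E)
    (hw : ∀ ψ : E → ℝ, ContDiff ℝ (⊤ : ℕ∞) ψ → HasCompactSupport ψ →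
      ∫ x, f x * fderiv ℝ ψ x h ∂μ = -∫ x, G x * ψ x ∂μ) :
    ∀ᵐ z ∂μ, f (z + h) - f z = ∫ t, G (z + t • h) ∂(volume.restrict (Set.Ioc (0 : ℝ) 1)) := by
  have hfh : LocallyIntegrable (fun z => f (z + h)) μ := by
    rw [locallyIntegrable_iff]
    intro K hK
    have := (measurePreserving_add_right μ h).integrableOn_comp_preimage
      (measurableEmbedding_addRight h) (f := f) (s := (fun z => z + h) '' K)
    rw [Set.preimage_image_eq _ (add_left_injective h)] at this
    exact this.2 (hf.integrableOn_isCompact (hK.image (by fun_prop)))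
  refine ae_eq_of_integral_contDiff_smul_eq (hfh.sub hf)
    (locallyIntegrable_integral_comp_add_smul hGm hG h) fun ψ hψ hψc => ?_
  obtain ⟨R, hR⟩ := hψc.isCompact.isBounded.exists_norm_le
  have hψ0 : ∀ z, R < ‖z‖ → ψ z = 0 := fun z hz => by
    by_contra hne
    exact absurd (hR z (subset_tsupport _ hne)) (not_le.2 hz)
  have hdψc : HasCompactSupport (fun z => fderiv ℝ ψ z h) := hψc.fderiv_apply (𝕜 := ℝ) h
  have hdψ : Continuous (fun z => fderiv ℝ ψ z h) :=
    (hψ.continuous_fderiv (by simp)).clm_apply continuous_const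
  have hdψ0 : ∀ z, R < ‖z‖ → fderiv ℝ ψ z h = 0 := fun z hz => by
    have : z ∉ tsupport (fderiv ℝ ψ) := fun hmem =>
      absurd (hR z (tsupport_fderiv_subset ℝ hmem)) (not_le.2 hz)
    simp [image_eq_zero_of_notMem_tsupport this]
  obtain ⟨B, hB⟩ := hψ.continuous.bounded_above_of_compact_support hψc
  obtain ⟨B', hB'⟩ := hdψ.bounded_above_of_compact_support hdψc
  have hind : ∀ {F : E → ℝ}, LocallyIntegrable F μ →
      Integrable ((closedBall (0 : E) (R + ‖h‖)).indicator F) μ := fun hF =>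
    (hF.integrableOn_isCompact (isCompact_closedBall _ _)).integrable_indicator
      measurableSet_closedBall
  have hae : ∀ᵐ p ∂(μ.prod (volume.restrict (Set.Ioc (0 : ℝ) 1))), p.2 ∈ Set.Ioc (0 : ℝ) 1 :=
    Measure.quasiMeasurePreserving_snd.ae (ae_restrict_mem measurableSet_Ioc)
  have hI₁ : Integrable (fun p : E × ℝ => f p.1 * fderiv ℝ ψ (p.1 - p.2 • h) h)
      (μ.prod (volume.restrict (Set.Ioc (0 : ℝ) 1))) := by
    have h1 := ((hind hf).comp_fst (volume.restrict (Set.Ioc (0 : ℝ) 1))).mul_bdd (c := B')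
      (g := fun p : E × ℝ => fderiv ℝ ψ (p.1 - p.2 • h) h)
      (hdψ.comp (by fun_prop)).aestronglyMeasurable (ae_of_all _ fun p => hB' _)
    refine h1.congr ?_
    filter_upwards [hae] with p hp
    by_cases hm : p.1 ∈ closedBall (0 : E) (R + ‖h‖)
    · simp [Set.indicator_of_mem hm]
    · have : R < ‖p.1 - p.2 • h‖ := by
        by_contra! hle
        have := norm_add_smul_le_of_mem_Ioc (h := h) hp hle
        simp at hm this
        linarith
      simp [hdψ0 _ this]
  have hI₂ : Integrable (fun p : E × ℝ => ψ p.1 * G (p.1 + p.2 • h))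
      (μ.prod (volume.restrict (Set.Ioc (0 : ℝ) 1))) := by
    have h1 := (integrable_comp_add_smul (hGm.indicator measurableSet_closedBall)
      (hind hG) h).bdd_mul (c := B) (f := fun p : E × ℝ => ψ p.1)
      (hψ.continuous.comp continuous_fst).aestronglyMeasurable (ae_of_all _ fun p => hB _)
    refine h1.congr ?_
    filter_upwards [hae] with p hp
    by_cases hm : ‖p.1‖ ≤ R
    · have : p.1 + p.2 • h ∈ closedBall (0 : E) (R + ‖h‖) := by
        simpa using norm_add_smul_le_of_mem_Ioc (h := h) hp hm
      simp [Set.indicator_of_mem this]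
    · simp [hψ0 _ (not_le.1 hm)]
  have hftc : ∀ z, ψ (z - h) - ψ z =
      -∫ t, fderiv ℝ ψ (z - t • h) h ∂(volume.restrict (Set.Ioc (0 : ℝ) 1)) := by
    intro z
    have hd : ∀ t ∈ Set.uIcc (0 : ℝ) 1,
        HasDerivAt (fun t : ℝ => ψ (z - t • h)) (-fderiv ℝ ψ (z - t • h) h) t := by
      intro t _
      have h1 : HasDerivAt (fun t : ℝ => z - t • h) (-h) t := by
        simpa using ((hasDerivAt_id t).smul_const h).const_sub z
      have h2 := ((hψ.differentiable (by simp)) (z - t • h)).hasFDerivAt.comp_hasDerivAt t h1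
      exact h2.congr_deriv (by simp)
    have := intervalIntegral.integral_eq_sub_of_hasDerivAt hd
      (Continuous.intervalIntegrable ((hdψ.comp (by fun_prop)).neg) _ _)
    rw [intervalIntegral.integral_of_le zero_le_one, integral_neg] at this
    simpa using this.symm
  have hmul : ∀ {F : E → ℝ} {φ : E → ℝ}, LocallyIntegrable F μ → Continuous φ →
      HasCompactSupport φ → Integrable (fun z => φ z * F z) μ := fun hF hφ hφc =>
    hF.integrable_smul_left_of_hasCompactSupport hφ hφc
  have hψs : ∀ a : E, HasCompactSupport (fun z => ψ (z - a)) := fun a =>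
    hψc.comp_homeomorph (Homeomorph.subRight a)
  calc ∫ z, ψ z • (f (z + h) - f z) ∂μ
      = ∫ z, ψ z * f (z + h) ∂μ - ∫ z, ψ z * f z ∂μ := by
        rw [← integral_sub (hmul hfh hψ.continuous hψc) (hmul hf hψ.continuous hψc)]
        simp [mul_sub]
    _ = ∫ z, ψ (z - h) * f z ∂μ - ∫ z, ψ z * f z ∂μ := by
        rw [← integral_add_right_eq_self (fun z => ψ (z - h) * f z) h]
        simp
    _ = ∫ z, f z * (ψ (z - h) - ψ z) ∂μ := by
        rw [← integral_sub (hmul (φ := fun z => ψ (z - h)) hf (by fun_prop) (hψs h))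
          (hmul hf hψ.continuous hψc)]
        congr with z
        ring
    _ = -∫ z, ∫ t, f z * fderiv ℝ ψ (z - t • h) h ∂(volume.restrict (Set.Ioc (0 : ℝ) 1)) ∂μ := by
        rw [← integral_neg]
        congr with z
        rw [hftc, integral_const_mul]
        ring
    _ = -∫ t, ∫ z, f z * fderiv ℝ ψ (z - t • h) h ∂μ ∂(volume.restrict (Set.Ioc (0 : ℝ) 1)) := by
        rw [integral_integral_swap hI₁]
    _ = ∫ t, ∫ z, ψ z * G (z + t • h) ∂μ ∂(volume.restrict (Set.Ioc (0 : ℝ) 1)) := by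
        rw [← integral_neg]
        congr with t
        have := hw (fun z => ψ (z - t • h)) (by fun_prop) (hψs _)
        simp only [fderiv_comp_sub] at this
        rw [this, neg_neg, ← integral_add_right_eq_self _ (t • h)]
        simp [mul_comm]
    _ = ∫ z, ψ z • ∫ t, G (z + t • h) ∂(volume.restrict (Set.Ioc (0 : ℝ) 1)) ∂μ := by
        rw [← integral_integral_swap hI₂]
        simp [integral_const_mul]


lemma setLIntegral_enorm_sub_le_of_weak_lineDeriv {f G : E → ℝ} (hf : LocallyIntegrable f μ)
    (hGm : Measurable G) (hG : LocallyIntegrable G μ) (h : E)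
    (hw : ∀ ψ : E → ℝ, ContDiff ℝ (⊤ : ℕ∞) ψ → HasCompactSupport ψ →
      ∫ x, f x * fderiv ℝ ψ x h ∂μ = -∫ x, G x * ψ x ∂μ)
    {s : Set E} (hs : Convex ℝ s) (hsm : MeasurableSet s) :
    ∫⁻ z in s ∩ (fun z => z + h) ⁻¹' s, ‖f (z + h) - f z‖ₑ ∂μ ≤ ∫⁻ z in s, ‖G z‖ₑ ∂μ := by
  set A := s ∩ (fun z => z + h) ⁻¹' s
  have hAm : MeasurableSet A := hsm.inter ((by fun_prop : Measurable fun z => z + h) hsm)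
  have hm : Measurable (fun p : E × ℝ => ‖G (p.1 + p.2 • h)‖ₑ) := by fun_prop
  calc ∫⁻ z in A, ‖f (z + h) - f z‖ₑ ∂μ
      = ∫⁻ z in A, ‖∫ t, G (z + t • h) ∂(volume.restrict (Set.Ioc (0 : ℝ) 1))‖ₑ ∂μ := by
        refine lintegral_congr_ae (ae_restrict_of_ae ?_)
        filter_upwards [ae_sub_eq_integral_of_weak_lineDeriv hf hGm hG h hw] with z hz
        rw [hz]
    _ ≤ ∫⁻ z in A, ∫⁻ t, ‖G (z + t • h)‖ₑ ∂(volume.restrict (Set.Ioc (0 : ℝ) 1)) ∂μ :=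
        lintegral_mono fun z => enorm_integral_le_lintegral_enorm _
    _ = ∫⁻ t, ∫⁻ z in A, ‖G (z + t • h)‖ₑ ∂μ ∂(volume.restrict (Set.Ioc (0 : ℝ) 1)) :=
        lintegral_lintegral_swap hm.aemeasurable
    _ ≤ ∫⁻ _ in Set.Ioc (0 : ℝ) 1, ∫⁻ z in s, ‖G z‖ₑ ∂μ := by
        refine setLIntegral_mono measurable_const fun t ht => ?_
        rw [← lintegral_indicator hAm, ← lintegral_indicator hsm,
          ← lintegral_add_right_eq_self (s.indicator fun z => ‖G z‖ₑ) (t • h)]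
        refine lintegral_mono fun z => ?_
        by_cases hz : z ∈ A
        · have : z + t • h ∈ s := hs.add_smul_mem hz.1 hz.2 ⟨ht.1.le, ht.2⟩
          simp [Set.indicator_of_mem hz, Set.indicator_of_mem this]
        · simp [Set.indicator_of_notMem hz]
    _ = ∫⁻ z in s, ‖G z‖ₑ ∂μ := by simp

end Translation

section Poincare

variable {n : ℕ}

lemma HasWeakPartialDeriv.congr_ae {f f' g g' : EuclideanSpace ℝ (Fin n) → ℝ} {i : Fin n}
    (h : HasWeakPartialDeriv f g i) (hf : f =ᵐ[volume] f') (hg : g =ᵐ[volume] g') :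
    HasWeakPartialDeriv f' g' i := by
  intro φ hφ hφc
  have h1 := integral_congr_ae (hf.mul (ae_eq_refl fun x =>
    fderiv ℝ φ x (EuclideanSpace.single i 1)))
  have h2 := integral_congr_ae (hg.mul (ae_eq_refl φ))
  simp only [Pi.mul_apply] at h1 h2
  rw [← h1, ← h2]
  exact h φ hφ hφc

lemma weak_lineDeriv_of_hasWeakPartialDeriv {f : EuclideanSpace ℝ (Fin n) → ℝ}
    {g : Fin n → EuclideanSpace ℝ (Fin n) → ℝ} (hf : LocallyIntegrable f)
    (hg : ∀ i, LocallyIntegrable (g i)) (hw : ∀ i, HasWeakPartialDeriv f (g i) i)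
    (h : EuclideanSpace ℝ (Fin n)) (ψ : EuclideanSpace ℝ (Fin n) → ℝ)
    (hψ : ContDiff ℝ (⊤ : ℕ∞) ψ) (hψc : HasCompactSupport ψ) :
    ∫ x, f x * fderiv ℝ ψ x h = -∫ x, (∑ i, h i * g i x) * ψ x := by
  have hdec : ∀ x, fderiv ℝ ψ x h = ∑ i, h i * fderiv ℝ ψ x (EuclideanSpace.single i 1) := by
    intro x
    conv_lhs => rw [← (EuclideanSpace.basisFun (Fin n) ℝ).sum_repr h]
    simp [map_sum]
  have h1 : ∀ i ∈ Finset.univ, Integrable fun x =>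
      h i * (f x * fderiv ℝ ψ x (EuclideanSpace.single i 1)) := fun i _ =>
    (hf.integrable_smul_right_of_hasCompactSupport
      ((hψ.continuous_fderiv (by simp)).clm_apply continuous_const)
      (hψc.fderiv_apply (𝕜 := ℝ) _)).const_mul _
  have h2 : ∀ i ∈ Finset.univ, Integrable fun x => h i * (g i x * ψ x) := fun i _ =>
    ((hg i).integrable_smul_right_of_hasCompactSupport hψ.continuous hψc).const_mul _
  calc ∫ x, f x * fderiv ℝ ψ x h
      = ∫ x, ∑ i, h i * (f x * fderiv ℝ ψ x (EuclideanSpace.single i 1)) := by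
        simp only [hdec, Finset.mul_sum]
        congr! 3
        ring
    _ = -∫ x, ∑ i, h i * (g i x * ψ x) := by
        rw [integral_finsetSum _ h1, integral_finsetSum _ h2, ← Finset.sum_neg_distrib]
        refine Finset.sum_congr rfl fun i _ => ?_
        rw [integral_const_mul, integral_const_mul, hw i ψ hψ hψc]
        ring
    _ = -∫ x, (∑ i, h i * g i x) * ψ x := by
        simp only [Finset.sum_mul, mul_assoc]

/-- A Poincaré inequality on balls for weakly differentiable functions. -/
lemma lintegral_lintegral_enorm_sub_le {f : EuclideanSpace ℝ (Fin n) → ℝ}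
    {g : Fin n → EuclideanSpace ℝ (Fin n) → ℝ} (hf : LocallyIntegrable f)
    (hg : ∀ i, LocallyIntegrable (g i)) (hw : ∀ i, HasWeakPartialDeriv f (g i) i)
    (c : EuclideanSpace ℝ (Fin n)) (r : ℝ) :
    ∫⁻ z in ball c r, ∫⁻ p in ball c r, ‖f p - f z‖ₑ ≤
      ENNReal.ofReal (2 * r) * volume (ball c (2 * r)) * ∫⁻ z in ball c r, ∑ i, ‖g i z‖ₑ := by
  wlog hm : Measurable f ∧ ∀ i, Measurable (g i) generalizing f g
  · have hfa := hf.aestronglyMeasurable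
    have hga := fun i => (hg i).aestronglyMeasurable
    have key := this (f := hfa.mk f) (g := fun i => (hga i).mk (g i))
      (hf.congr hfa.ae_eq_mk) (fun i => (hg i).congr (hga i).ae_eq_mk)
      (fun i => (hw i).congr_ae hfa.ae_eq_mk (hga i).ae_eq_mk)
      ⟨hfa.stronglyMeasurable_mk.measurable, fun i => (hga i).stronglyMeasurable_mk.measurable⟩
    refine le_trans (le_of_eq ?_) (key.trans (le_of_eq ?_))
    · refine lintegral_congr_ae (ae_restrict_of_ae ?_)
      filter_upwards [hfa.ae_eq_mk] with z hz
      refine lintegral_congr_ae (ae_restrict_of_ae ?_)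
      filter_upwards [hfa.ae_eq_mk] with p hp
      rw [hz, hp]
    · congr 1
      refine lintegral_congr_ae (ae_restrict_of_ae ?_)
      filter_upwards [ae_all_iff.2 fun i => (hga i).ae_eq_mk] with z hz
      simp only [hz]
  obtain ⟨hfm, hgm⟩ := hm
  set s := ball c r with hs
  have hsm : MeasurableSet s := measurableSet_ball
  set F : EuclideanSpace ℝ (Fin n) → EuclideanSpace ℝ (Fin n) → ℝ≥0∞ := fun z p =>
    (s ×ˢ s).indicator (fun q => ‖f q.2 - f q.1‖ₑ) (z, p) with hF
  have hFm : Measurable (Function.uncurry F) := by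
    have : Measurable ((s ×ˢ s).indicator
        (fun q : EuclideanSpace ℝ (Fin n) × EuclideanSpace ℝ (Fin n) => ‖f q.2 - f q.1‖ₑ)) :=
      Measurable.indicator (by fun_prop) (hsm.prod hsm)
    exact this
  have hFm' : Measurable (fun q : EuclideanSpace ℝ (Fin n) × EuclideanSpace ℝ (Fin n) =>
      F q.1 (q.1 + q.2)) := hFm.comp (by fun_prop : Measurable fun
        q : EuclideanSpace ℝ (Fin n) × EuclideanSpace ℝ (Fin n) => (q.1, q.1 + q.2))
  calc ∫⁻ z in s, ∫⁻ p in s, ‖f p - f z‖ₑ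
      = ∫⁻ z, ∫⁻ p, F z p := by
        rw [← lintegral_indicator hsm]
        congr with z
        by_cases hz : z ∈ s
        · rw [Set.indicator_of_mem hz, ← lintegral_indicator hsm]
          congr with p
          by_cases hp : p ∈ s <;> simp [hF, hz, hp]
        · simp [hF, hz]
    _ = ∫⁻ z, ∫⁻ h, F z (z + h) := by
        congr with z
        exact (lintegral_add_left_eq_self (fun p => F z p) z).symm
    _ = ∫⁻ h, ∫⁻ z, F z (z + h) := lintegral_lintegral_swap hFm'.aemeasurable
    _ ≤ ∫⁻ h, (ball (0 : EuclideanSpace ℝ (Fin n)) (2 * r)).indicator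
          (fun _ => ENNReal.ofReal (2 * r) * ∫⁻ z in s, ∑ i, ‖g i z‖ₑ) h := by
        refine lintegral_mono fun h => ?_
        by_cases hh : h ∈ ball (0 : EuclideanSpace ℝ (Fin n)) (2 * r)
        · rw [Set.indicator_of_mem hh]
          have hA : MeasurableSet (s ∩ (fun z => z + h) ⁻¹' s) :=
            hsm.inter ((by fun_prop : Measurable fun z => z + h) hsm)
          have hGl : LocallyIntegrable (fun z => ∑ i, h i * g i z) :=
            locallyIntegrable_finsetSum (μ := volume) Finset.univ
              (f := fun i z => h i * g i z) fun i _ => (hg i).smul (h i)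
          calc ∫⁻ z, F z (z + h)
              = ∫⁻ z in s ∩ (fun z => z + h) ⁻¹' s, ‖f (z + h) - f z‖ₑ := by
                rw [← lintegral_indicator hA]
                rfl
            _ ≤ ∫⁻ z in s, ‖∑ i, h i * g i z‖ₑ :=
                setLIntegral_enorm_sub_le_of_weak_lineDeriv hf (by fun_prop) hGl h
                  (weak_lineDeriv_of_hasWeakPartialDeriv hf hg hw h) (convex_ball c r) hsm
            _ ≤ ∫⁻ z in s, ENNReal.ofReal (2 * r) * ∑ i, ‖g i z‖ₑ := by
                refine lintegral_mono fun z => (enorm_sum_le _ _).trans ?_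
                rw [Finset.mul_sum]
                refine Finset.sum_le_sum fun i _ => ?_
                rw [enorm_mul]
                gcongr
                rw [← ofReal_norm]
                refine ENNReal.ofReal_le_ofReal ((PiLp.norm_apply_le h i).trans ?_)
                simpa using (mem_ball_zero_iff.1 hh).le
            _ = _ := lintegral_const_mul _ (by fun_prop)
        · rw [Set.indicator_of_notMem hh, nonpos_iff_eq_zero]
          refine lintegral_eq_zero_of_ae_eq_zero (ae_of_all _ fun z => ?_)
          refine Set.indicator_of_notMem (fun hmem => hh ?_) _
          have h1 := mem_ball.1 hmem.1
          have h2 := mem_ball.1 hmem.2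
          rw [mem_ball_zero_iff]
          calc ‖h‖ = dist (z + h) z := by simp [dist_eq_norm]
            _ ≤ dist (z + h) c + dist z c := dist_triangle_right _ _ _
            _ < 2 * r := by linarith
    _ = _ := by
        rw [lintegral_indicator measurableSet_ball, setLIntegral_const,
          Measure.addHaar_ball_center volume c]
        ring

end Poincare

section Averages

variable {n : ℕ}

lemma abs_setAverage_sub_le {E : Type*} [MeasurableSpace E] {μ : Measure E} {s : Set E}
    {f : E → ℝ} (hf : IntegrableOn f s μ) (h0 : μ s ≠ 0) (ht : μ s ≠ ∞) {q κ : ℝ} (hκ : 0 ≤ κ)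
    (h : ∫⁻ z in s, ‖f z - q‖ₑ ∂μ ≤ ENNReal.ofReal κ * μ s) :
    |(⨍ z in s, f z ∂μ) - q| ≤ κ := by
  have hpos : 0 < μ.real s := ENNReal.toReal_pos h0 ht
  have hc : IntegrableOn (fun _ => q) s μ := integrableOn_const ht
  have h1 : (⨍ z in s, f z ∂μ) - q = (μ.real s)⁻¹ * ∫ z in s, (f z - q) ∂μ := by
    rw [setAverage_eq, integral_sub hf hc, setIntegral_const, smul_eq_mul, smul_eq_mul]
    field_simp
  have h2 : |∫ z in s, (f z - q) ∂μ| ≤ κ * μ.real s := by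
    rw [← Real.norm_eq_abs]
    have h3 := (enorm_integral_le_lintegral_enorm (μ := μ.restrict s) fun z => f z - q).trans h
    have h4 := ENNReal.toReal_mono (ENNReal.mul_ne_top ENNReal.ofReal_ne_top ht) h3
    simpa [ENNReal.toReal_ofReal hκ, Measure.real] using h4
  rw [h1, abs_mul, abs_of_pos (inv_pos.2 hpos), inv_mul_le_iff₀ hpos, mul_comm]
  exact h2

lemma enorm_sub_setAverage_le {E : Type*} [MeasurableSpace E] {μ : Measure E} {s : Set E}
    {f : E → ℝ} (hf : IntegrableOn f s μ) (h0 : μ s ≠ 0) (ht : μ s ≠ ∞) (q : ℝ) :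
    ‖q - ⨍ z in s, f z ∂μ‖ₑ ≤ (μ s)⁻¹ * ∫⁻ z in s, ‖f z - q‖ₑ ∂μ := by
  have hfin : ∫⁻ z in s, ‖f z - q‖ₑ ∂μ ≠ ∞ := (hf.sub (integrableOn_const ht)).2.ne
  have hfin' : (μ s)⁻¹ * ∫⁻ z in s, ‖f z - q‖ₑ ∂μ ≠ ∞ :=
    ENNReal.mul_ne_top (ENNReal.inv_ne_top.2 h0) hfin
  rw [← ofReal_norm, ENNReal.ofReal_le_iff_le_toReal hfin', norm_sub_rev, Real.norm_eq_abs]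
  refine abs_setAverage_sub_le hf h0 ht ENNReal.toReal_nonneg ?_
  rw [ENNReal.ofReal_toReal hfin', mul_comm, ← mul_assoc, ENNReal.mul_inv_cancel h0 ht, one_mul]

lemma LocallyIntegrable.integrableOn_ball {f : EuclideanSpace ℝ (Fin n) → ℝ}
    (hf : LocallyIntegrable f) (c : EuclideanSpace ℝ (Fin n)) (r : ℝ) :
    IntegrableOn f (ball c r) :=
  (hf.integrableOn_isCompact (isCompact_closedBall c r)).mono_set ball_subset_closedBall

/-- The mean oscillation of a weakly differentiable function over a ball, on a ball of
comparable size inside it. -/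
lemma lintegral_enorm_sub_setAverage_le {f : EuclideanSpace ℝ (Fin n) → ℝ}
    {g : Fin n → EuclideanSpace ℝ (Fin n) → ℝ} (hf : LocallyIntegrable f)
    (hg : ∀ i, LocallyIntegrable (g i)) (hw : ∀ i, HasWeakPartialDeriv f (g i) i)
    {a c : EuclideanSpace ℝ (Fin n)} {s r K : ℝ} (hr : 0 < r) (hrs : r ≤ 2 * s)
    (hsub : ball a s ⊆ ball c r)
    (h : ∫⁻ z in ball c r, ∑ i, ‖g i z‖ₑ ≤ ENNReal.ofReal K * volume (ball c r)) :
    ∫⁻ p in ball a s, ‖f p - ⨍ z in ball c r, f z‖ₑ ≤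
      ENNReal.ofReal (2 * 4 ^ n * r * K) * volume (ball a s) := by
  have h0 : volume (ball c r) ≠ 0 := (measure_ball_pos _ _ hr).ne'
  have ht : volume (ball c r) ≠ ∞ := measure_ball_lt_top.ne
  have hV : volume (ball c (2 * r)) ≤ ENNReal.ofReal (4 ^ n) * volume (ball a s) := by
    calc volume (ball c (2 * r)) ≤ volume (ball c (4 * s)) :=
          measure_mono (ball_subset_ball (by linarith))
      _ = _ := by
        rw [Measure.addHaar_ball_mul_of_pos volume c (by norm_num : (0 : ℝ) < 4) s,
          finrank_euclideanSpace_fin, Measure.addHaar_ball_center volume a]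
  calc ∫⁻ p in ball a s, ‖f p - ⨍ z in ball c r, f z‖ₑ
      ≤ ∫⁻ p in ball c r, ‖f p - ⨍ z in ball c r, f z‖ₑ := lintegral_mono_set hsub
    _ ≤ ∫⁻ p in ball c r, (volume (ball c r))⁻¹ * ∫⁻ z in ball c r, ‖f z - f p‖ₑ :=
        lintegral_mono fun p =>
          enorm_sub_setAverage_le (LocallyIntegrable.integrableOn_ball hf c r) h0 ht (f p)
    _ = (volume (ball c r))⁻¹ * ∫⁻ p in ball c r, ∫⁻ z in ball c r, ‖f z - f p‖ₑ :=
        lintegral_const_mul' _ _ (ENNReal.inv_ne_top.2 h0)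
    _ ≤ (volume (ball c r))⁻¹ * (ENNReal.ofReal (2 * r) *
          (ENNReal.ofReal (4 ^ n) * volume (ball a s)) *
          (ENNReal.ofReal K * volume (ball c r))) := by
        gcongr
        refine (lintegral_lintegral_enorm_sub_le hf hg hw c r).trans ?_
        gcongr
    _ = ((volume (ball c r))⁻¹ * volume (ball c r)) *
          (ENNReal.ofReal (2 * r) * ENNReal.ofReal (4 ^ n) * ENNReal.ofReal K) *
            volume (ball a s) := by ring
    _ = _ := by
        rw [ENNReal.inv_mul_cancel h0 ht, one_mul, ← ENNReal.ofReal_mul (by positivity),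
          ← ENNReal.ofReal_mul (by positivity)]
        congr 2
        ring

lemma abs_setAverage_sub_setAverage_le {f : EuclideanSpace ℝ (Fin n) → ℝ}
    {g : Fin n → EuclideanSpace ℝ (Fin n) → ℝ} (hf : LocallyIntegrable f)
    (hg : ∀ i, LocallyIntegrable (g i)) (hw : ∀ i, HasWeakPartialDeriv f (g i) i)
    {a c : EuclideanSpace ℝ (Fin n)} {s r K : ℝ} (hr : 0 < r) (hrs : r ≤ 2 * s)
    (hsub : ball a s ⊆ ball c r) (hK : 0 ≤ K)
    (h : ∫⁻ z in ball c r, ∑ i, ‖g i z‖ₑ ≤ ENNReal.ofReal K * volume (ball c r)) :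
    |(⨍ z in ball a s, f z) - ⨍ z in ball c r, f z| ≤ 2 * 4 ^ n * r * K :=
  abs_setAverage_sub_le (LocallyIntegrable.integrableOn_ball hf a s)
    (measure_ball_pos _ _ (by linarith)).ne' measure_ball_lt_top.ne (by positivity)
    (lintegral_enorm_sub_setAverage_le hf hg hw hr hrs hsub h)

/-- Averages over concentric balls of a weakly differentiable function whose gradient has
bounded averages. -/
lemma abs_setAverage_sub_setAverage_le_of_concentric {f : EuclideanSpace ℝ (Fin n) → ℝ}
    {g : Fin n → EuclideanSpace ℝ (Fin n) → ℝ} (hf : LocallyIntegrable f)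
    (hg : ∀ i, LocallyIntegrable (g i)) (hw : ∀ i, HasWeakPartialDeriv f (g i) i)
    {c : EuclideanSpace ℝ (Fin n)} {ρ K : ℝ} (hK : 0 ≤ K)
    (h : ∀ r, 0 < r → r ≤ ρ →
      ∫⁻ z in ball c r, ∑ i, ‖g i z‖ₑ ≤ ENNReal.ofReal K * volume (ball c r))
    {s r : ℝ} (hs : 0 < s) (hsr : s ≤ r) (hr : r ≤ ρ) :
    |(⨍ z in ball c s, f z) - ⨍ z in ball c r, f z| ≤ 4 * 4 ^ n * r * K := by
  have key : ∀ (j : ℕ) (r : ℝ), 0 < r → r ≤ ρ → ∀ s, 0 < s → s ≤ r → r ≤ 2 ^ j * s →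
      |(⨍ z in ball c s, f z) - ⨍ z in ball c r, f z| ≤ 4 * 4 ^ n * r * K := by
    intro j
    induction j with
    | zero =>
      intro r hr0 hrρ s hs hsr hj
      obtain rfl : s = r := le_antisymm hsr (by simpa using hj)
      simp only [sub_self, abs_zero]
      positivity
    | succ j ih =>
      intro r hr0 hrρ s hs hsr hj
      have hnn : 0 ≤ 4 ^ n * r * K := by positivity
      by_cases h2 : r ≤ 2 * s
      · refine (abs_setAverage_sub_setAverage_le hf hg hw hr0 h2 (ball_subset_ball hsr) hK
          (h r hr0 hrρ)).trans ?_
        linarith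
      · have h3 := ih (r / 2) (by linarith) (by linarith) s hs (by linarith)
          (by rw [pow_succ] at hj; linarith)
        have h4 := abs_setAverage_sub_setAverage_le (a := c) (s := r / 2) hf hg hw hr0
          (by linarith) (ball_subset_ball (by linarith)) hK (h r hr0 hrρ)
        refine (abs_sub_le _ _ _).trans ((add_le_add h3 h4).trans (le_of_eq ?_))
        ring
  obtain ⟨j, hj⟩ := pow_unbounded_of_one_lt (r / s) (one_lt_two (α := ℝ))
  exact key j r (hs.trans_le hsr) hr s hs hsr ((div_lt_iff₀ hs).1 hj).le

lemma tendsto_setAverage_rep {f : EuclideanSpace ℝ (Fin n) → ℝ}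
    {g : Fin n → EuclideanSpace ℝ (Fin n) → ℝ} (hf : LocallyIntegrable f)
    (hg : ∀ i, LocallyIntegrable (g i)) (hw : ∀ i, HasWeakPartialDeriv f (g i) i)
    {c : EuclideanSpace ℝ (Fin n)} {ρ K : ℝ} (hρ : 0 < ρ) (hK : 0 ≤ K)
    (h : ∀ r, 0 < r → r ≤ ρ →
      ∫⁻ z in ball c r, ∑ i, ‖g i z‖ₑ ≤ ENNReal.ofReal K * volume (ball c r)) :
    Tendsto (fun r : ℝ => ⨍ z in ball c r, f z) (nhdsWithin 0 (Set.Ioi 0)) (nhds (rep f c)) := by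
  have hex : ∃ L, Tendsto (fun r : ℝ => ⨍ z in ball c r, f z) (nhdsWithin 0 (Set.Ioi 0))
      (nhds L) := by
    rw [← cauchy_map_iff_exists_tendsto, Metric.cauchy_iff]
    refine ⟨inferInstance, fun ε hε => ?_⟩
    set δ := min ρ (ε / (2 * (4 * 4 ^ n * (K + 1)))) with hδ
    have hδ0 : 0 < δ := lt_min hρ (by positivity)
    refine ⟨_, image_mem_map (Ioo_mem_nhdsGT hδ0), ?_⟩
    have hb : ∀ s ∈ Set.Ioo 0 δ, ∀ t ∈ Set.Ioo 0 δ, s ≤ t →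
        |(⨍ z in ball c s, f z) - ⨍ z in ball c t, f z| < ε := by
      intro s hs t ht hst
      refine (abs_setAverage_sub_setAverage_le_of_concentric hf hg hw hK h hs.1 hst
        (ht.2.le.trans (min_le_left _ _))).trans_lt ?_
      have h1 : t < ε / (2 * (4 * 4 ^ n * (K + 1))) := ht.2.trans_le (min_le_right _ _)
      rw [lt_div_iff₀ (by positivity)] at h1
      have h2 : 0 < 4 * 4 ^ n * t := by have := ht.1; positivity
      nlinarith
    rintro _ ⟨s, hs, rfl⟩ _ ⟨t, ht, rfl⟩
    rw [Real.dist_eq]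
    rcases le_total s t with hst | hst
    · exact hb s hs t ht hst
    · rw [abs_sub_comm]
      exact hb t ht s hs hst
  obtain ⟨L, hL⟩ := hex
  rwa [rep, hL.limsup_eq]

lemma abs_sub_setAverage_le_of_tendsto {f : EuclideanSpace ℝ (Fin n) → ℝ}
    {g : Fin n → EuclideanSpace ℝ (Fin n) → ℝ} (hf : LocallyIntegrable f)
    (hg : ∀ i, LocallyIntegrable (g i)) (hw : ∀ i, HasWeakPartialDeriv f (g i) i)
    {c : EuclideanSpace ℝ (Fin n)} {ρ K L : ℝ} (hρ : 0 < ρ) (hK : 0 ≤ K)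
    (h : ∀ r, 0 < r → r ≤ ρ →
      ∫⁻ z in ball c r, ∑ i, ‖g i z‖ₑ ≤ ENNReal.ofReal K * volume (ball c r))
    (hL : Tendsto (fun r : ℝ => ⨍ z in ball c r, f z) (nhdsWithin 0 (Set.Ioi 0)) (nhds L)) :
    |L - ⨍ z in ball c ρ, f z| ≤ 4 * 4 ^ n * ρ * K := by
  refine le_of_tendsto (hL.sub_const _).abs ?_
  filter_upwards [Ioc_mem_nhdsGT hρ] with s hs
  exact abs_setAverage_sub_setAverage_le_of_concentric hf hg hw hK h hs.1 hs.2 le_rfl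

/-- If the averages of the gradient over small balls are bounded, so are those of the
function. -/
lemma exists_lintegral_enorm_le {f : EuclideanSpace ℝ (Fin n) → ℝ}
    {g : Fin n → EuclideanSpace ℝ (Fin n) → ℝ} (hf : LocallyIntegrable f)
    (hg : ∀ i, LocallyIntegrable (g i)) (hw : ∀ i, HasWeakPartialDeriv f (g i) i)
    {c : EuclideanSpace ℝ (Fin n)} {ρ K : ℝ} (hK : 0 ≤ K)
    (h : ∀ r, 0 < r → r ≤ ρ →
      ∫⁻ z in ball c r, ∑ i, ‖g i z‖ₑ ≤ ENNReal.ofReal K * volume (ball c r)) :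
    ∃ K', 0 ≤ K' ∧ ∀ r, 0 < r → r ≤ ρ →
      ∫⁻ z in ball c r, ‖f z‖ₑ ≤ ENNReal.ofReal K' * volume (ball c r) := by
  set q := ⨍ z in ball c ρ, f z
  refine ⟨|4 * 4 ^ n * ρ * K + |q| + 2 * 4 ^ n * ρ * K|, abs_nonneg _, fun r hr hrρ => ?_⟩
  set a := ⨍ z in ball c r, f z with ha
  have h1 : |a| ≤ 4 * 4 ^ n * ρ * K + |q| := by
    have := abs_setAverage_sub_setAverage_le_of_concentric hf hg hw hK h hr hrρ le_rfl
    have h2 := abs_sub_abs_le_abs_sub a q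
    linarith
  have hosc := lintegral_enorm_sub_setAverage_le (a := c) (s := r) hf hg hw hr (by linarith)
    subset_rfl (h r hr hrρ)
  calc ∫⁻ z in ball c r, ‖f z‖ₑ ≤ ∫⁻ z in ball c r, (‖f z - a‖ₑ + ‖a‖ₑ) :=
        lintegral_mono fun z => by simpa using enorm_add_le (f z - a) a
    _ = (∫⁻ z in ball c r, ‖f z - a‖ₑ) + ‖a‖ₑ * volume (ball c r) := by
        rw [lintegral_add_right _ measurable_const, setLIntegral_const]
    _ ≤ ENNReal.ofReal (2 * 4 ^ n * r * K) * volume (ball c r) +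
          ENNReal.ofReal |a| * volume (ball c r) := by
        gcongr
        rw [← ofReal_norm, Real.norm_eq_abs]
    _ = ENNReal.ofReal (2 * 4 ^ n * r * K + |a|) * volume (ball c r) := by
        rw [ENNReal.ofReal_add (by positivity) (abs_nonneg _), add_mul]
    _ ≤ _ := by
        gcongr
        refine le_trans ?_ (le_abs_self _)
        have : 2 * 4 ^ n * r * K ≤ 2 * 4 ^ n * ρ * K := by gcongr
        linarith

/-- Averages of a product with a function continuous at the center. -/
lemma tendsto_setAverage_mul {f P : EuclideanSpace ℝ (Fin n) → ℝ} (hf : LocallyIntegrable f)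
    (hP : Continuous P) {c : EuclideanSpace ℝ (Fin n)} {ρ K L : ℝ} (hρ : 0 < ρ) (hK : 0 ≤ K)
    (h : ∀ r, 0 < r → r ≤ ρ →
      ∫⁻ z in ball c r, ‖f z‖ₑ ≤ ENNReal.ofReal K * volume (ball c r))
    (hL : Tendsto (fun r : ℝ => ⨍ z in ball c r, f z) (nhdsWithin 0 (Set.Ioi 0)) (nhds L)) :
    Tendsto (fun r : ℝ => ⨍ z in ball c r, f z * P z) (nhdsWithin 0 (Set.Ioi 0))
      (nhds (L * P c)) := by
  have hfP : LocallyIntegrable (fun z => f z * P z) := by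
    rw [locallyIntegrable_iff]
    exact fun k hk => (hf.integrableOn_isCompact hk).mul_continuousOn hP.continuousOn hk
  have hd : Tendsto (fun r : ℝ => (⨍ z in ball c r, f z * P z) - (⨍ z in ball c r, f z) * P c)
      (nhdsWithin 0 (Set.Ioi 0)) (nhds 0) := by
    rw [Metric.tendsto_nhds]
    intro ε hε
    obtain ⟨δ, hδ, hPδ⟩ := Metric.continuous_iff.1 hP c (ε / (2 * (K + 1))) (by positivity)
    filter_upwards [Ioo_mem_nhdsGT (lt_min hρ hδ)] with r hr
    have hi : IntegrableOn (fun z => f z * P z - f z * P c) (ball c r) :=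
      (LocallyIntegrable.integrableOn_ball hfP c r).sub
        ((LocallyIntegrable.integrableOn_ball hf c r).mul_const _)
    have heq : (⨍ z in ball c r, f z * P z) - (⨍ z in ball c r, f z) * P c =
        ⨍ z in ball c r, (f z * P z - f z * P c) := by
      simp only [setAverage_eq]
      rw [integral_sub (LocallyIntegrable.integrableOn_ball hfP c r)
        ((LocallyIntegrable.integrableOn_ball hf c r).mul_const _), integral_mul_const]
      simp only [smul_eq_mul]
      ring
    rw [heq, Real.dist_eq]
    have hle : |(⨍ z in ball c r, (f z * P z - f z * P c)) - 0| ≤ ε / (2 * (K + 1)) * K := by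
      refine abs_setAverage_sub_le hi (measure_ball_pos _ _ hr.1).ne' measure_ball_lt_top.ne
        (by positivity) ?_
      calc ∫⁻ z in ball c r, ‖f z * P z - f z * P c - 0‖ₑ
          ≤ ∫⁻ z in ball c r, ENNReal.ofReal (ε / (2 * (K + 1))) * ‖f z‖ₑ := by
            refine setLIntegral_mono' measurableSet_ball fun z hz => ?_
            rw [sub_zero, ← mul_sub, enorm_mul, mul_comm]
            gcongr
            rw [← ofReal_norm, ← dist_eq_norm]
            exact ENNReal.ofReal_le_ofReal
              (hPδ z ((mem_ball.1 hz).trans (hr.2.trans_le (min_le_right _ _)))).le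
        _ = ENNReal.ofReal (ε / (2 * (K + 1))) * ∫⁻ z in ball c r, ‖f z‖ₑ :=
            lintegral_const_mul' _ _ ENNReal.ofReal_ne_top
        _ ≤ ENNReal.ofReal (ε / (2 * (K + 1))) * (ENNReal.ofReal K * volume (ball c r)) := by
            gcongr
            exact h r hr.1 (hr.2.le.trans (min_le_left _ _))
        _ = _ := by rw [ENNReal.ofReal_mul (by positivity), mul_assoc]
    refine hle.trans_lt ?_
    rw [div_mul_eq_mul_div, div_lt_iff₀ (by positivity)]
    nlinarith
  simpa using hd.add (hL.mul_const (P c))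

end Averages

section Taylor

variable {n : ℕ}

lemma HasWeakPartialDeriv.mul_contDiff {f g P : EuclideanSpace ℝ (Fin n) → ℝ} {i : Fin n}
    (h : HasWeakPartialDeriv f g i) (hf : LocallyIntegrable f) (hg : LocallyIntegrable g)
    (hP : ContDiff ℝ (⊤ : ℕ∞) P) :
    HasWeakPartialDeriv (fun z => f z * P z)
      (fun z => g z * P z + f z * fderiv ℝ P z (EuclideanSpace.single i 1)) i := by
  intro φ hφ hφc
  set e : EuclideanSpace ℝ (Fin n) := EuclideanSpace.single i 1
  have hdP : Continuous fun z => fderiv ℝ P z e :=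
    (hP.continuous_fderiv (by simp)).clm_apply continuous_const
  have hdφ : Continuous fun z => fderiv ℝ φ z e :=
    (hφ.continuous_fderiv (by simp)).clm_apply continuous_const
  have key : ∫ z, f z * fderiv ℝ (fun z => P z * φ z) z e = -∫ z, g z * (P z * φ z) :=
    h (fun z => P z * φ z) (hP.mul hφ) hφc.mul_left
  have hd : ∀ z, fderiv ℝ (fun z => P z * φ z) z e = P z * fderiv ℝ φ z e + φ z * fderiv ℝ P z e := by
    intro z
    rw [fderiv_fun_mul (hP.differentiable (by simp) z) (hφ.differentiable (by simp) z)]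
    simp
  have i1 : Integrable fun z => f z * (P z * fderiv ℝ φ z e) :=
    hf.integrable_smul_right_of_hasCompactSupport (hP.continuous.mul hdφ)
      (hφc.fderiv_apply (𝕜 := ℝ) e).mul_left
  have i2 : Integrable fun z => f z * (φ z * fderiv ℝ P z e) :=
    hf.integrable_smul_right_of_hasCompactSupport (hφ.continuous.mul hdP) hφc.mul_right
  have i3 : Integrable fun z => g z * (P z * φ z) :=
    hg.integrable_smul_right_of_hasCompactSupport (hP.continuous.mul hφ.continuous) hφc.mul_left
  simp only [hd, mul_add] at key
  rw [integral_add i1 i2] at key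
  have e1 : ∫ z, f z * P z * fderiv ℝ φ z e = ∫ z, f z * (P z * fderiv ℝ φ z e) := by
    simp only [mul_assoc]
  have e2 : ∫ z, (g z * P z + f z * fderiv ℝ P z e) * φ z =
      (∫ z, g z * (P z * φ z)) + ∫ z, f z * (φ z * fderiv ℝ P z e) := by
    rw [← integral_add i3 i2]
    congr with z
    ring
  rw [e1, e2]
  linarith

lemma HasWeakPartialDeriv.finset_sum {ι : Type*} {s : Finset ι}
    {f g : ι → EuclideanSpace ℝ (Fin n) → ℝ} {i : Fin n}
    (h : ∀ k ∈ s, HasWeakPartialDeriv (f k) (g k) i) (hf : ∀ k ∈ s, LocallyIntegrable (f k))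
    (hg : ∀ k ∈ s, LocallyIntegrable (g k)) :
    HasWeakPartialDeriv (fun z => ∑ k ∈ s, f k z) (fun z => ∑ k ∈ s, g k z) i := by
  intro φ hφ hφc
  simp only [Finset.sum_mul]
  rw [integral_finsetSum, integral_finsetSum, ← Finset.sum_neg_distrib]
  · exact Finset.sum_congr rfl fun k hk => h k hk φ hφ hφc
  · exact fun k hk => (hg k hk).integrable_smul_right_of_hasCompactSupport hφ.continuous hφc
  · exact fun k hk => (hf k hk).integrable_smul_right_of_hasCompactSupport
      ((hφ.continuous_fderiv (by simp)).clm_apply continuous_const)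
      (hφc.fderiv_apply (𝕜 := ℝ) _)

lemma LocallyIntegrable.mul_continuous {f P : EuclideanSpace ℝ (Fin n) → ℝ}
    (hf : LocallyIntegrable f) (hP : Continuous P) : LocallyIntegrable fun z => f z * P z := by
  rw [locallyIntegrable_iff]
  exact fun k hk => (hf.integrableOn_isCompact hk).mul_continuousOn hP.continuousOn hk

/-- The Taylor monomial `(y - z)^β / β!`. -/
noncomputable def taylorMonomial (y : EuclideanSpace ℝ (Fin n)) (β : Fin n → ℕ)
    (z : EuclideanSpace ℝ (Fin n)) : ℝ :=
  ∏ i, (y i - z i) ^ β i / (Nat.factorial (β i) : ℝ)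

lemma contDiff_taylorMonomial (y : EuclideanSpace ℝ (Fin n)) (β : Fin n → ℕ) :
    ContDiff ℝ (⊤ : ℕ∞) (taylorMonomial y β) := by
  unfold taylorMonomial
  fun_prop

lemma taylorMonomial_self (y : EuclideanSpace ℝ (Fin n)) {β : Fin n → ℕ} (hβ : β ≠ 0) :
    taylorMonomial y β y = 0 := by
  obtain ⟨i, hi⟩ := Function.ne_iff.1 hβ
  refine Finset.prod_eq_zero (Finset.mem_univ i) ?_
  simp [show β i ≠ 0 from hi]

lemma taylorMonomial_zero (y z : EuclideanSpace ℝ (Fin n)) : taylorMonomial y 0 z = 1 := by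
  simp [taylorMonomial]

lemma abs_taylorMonomial_le (y z : EuclideanSpace ℝ (Fin n)) (β : Fin n → ℕ) :
    |taylorMonomial y β z| ≤ ‖y - z‖ ^ ∑ i, β i := by
  rw [taylorMonomial, Finset.abs_prod, ← Finset.prod_pow_eq_pow_sum]
  refine Finset.prod_le_prod (fun _ _ => abs_nonneg _) fun i _ => ?_
  rw [abs_div, abs_pow, Nat.abs_cast]
  refine (div_le_self (by positivity) (by exact_mod_cast Nat.succ_le_of_lt (Nat.factorial_pos _))).trans ?_
  gcongr
  simpa using PiLp.norm_apply_le (y - z) i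

lemma taylorMonomial_add_smul_single (y z : EuclideanSpace ℝ (Fin n)) (β : Fin n → ℕ) (i : Fin n)
    (t : ℝ) :
    taylorMonomial y β (z + t • EuclideanSpace.single i 1) =
      (y i - z i - t) ^ β i / (Nat.factorial (β i) : ℝ) *
        ∏ j ∈ Finset.univ.erase i, (y j - z j) ^ β j / (Nat.factorial (β j) : ℝ) := by
  rw [taylorMonomial, ← Finset.mul_prod_erase _ _ (Finset.mem_univ i)]
  congr 1
  · simp [sub_sub]
  · refine Finset.prod_congr rfl fun j hj => ?_
    simp [Finset.ne_of_mem_erase hj]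

lemma fderiv_taylorMonomial_single_eq {y z : EuclideanSpace ℝ (Fin n)} {β : Fin n → ℕ} {i : Fin n}
    {d : ℝ} (h : HasDerivAt (fun t : ℝ => taylorMonomial y β (z + t • EuclideanSpace.single i 1))
      d 0) :
    fderiv ℝ (taylorMonomial y β) z (EuclideanSpace.single i 1) = d := by
  have h1 := ((contDiff_taylorMonomial y β).differentiable (by simp) z).hasFDerivAt.hasLineDerivAt
    (EuclideanSpace.single i (1 : ℝ))
  exact HasDerivAt.unique h1 h

lemma fderiv_taylorMonomial_of_eq_zero (y z : EuclideanSpace ℝ (Fin n)) {β : Fin n → ℕ}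
    {i : Fin n} (hβ : β i = 0) :
    fderiv ℝ (taylorMonomial y β) z (EuclideanSpace.single i 1) = 0 := by
  refine fderiv_taylorMonomial_single_eq ?_
  simp only [taylorMonomial_add_smul_single, hβ, pow_zero]
  exact hasDerivAt_const _ _

lemma fderiv_taylorMonomial_add_single (y z : EuclideanSpace ℝ (Fin n)) (β : Fin n → ℕ)
    (i : Fin n) :
    fderiv ℝ (taylorMonomial y (β + Pi.single i 1)) z (EuclideanSpace.single i 1) =
      -taylorMonomial y β z := by
  refine fderiv_taylorMonomial_single_eq ?_
  simp only [taylorMonomial_add_smul_single]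
  have h0 := taylorMonomial_add_smul_single y z β i 0
  rw [zero_smul, add_zero, sub_zero] at h0
  have hprod : ∏ j ∈ Finset.univ.erase i, (y j - z j) ^ (β + Pi.single i 1 : Fin n → ℕ) j /
        (Nat.factorial ((β + Pi.single i 1 : Fin n → ℕ) j) : ℝ) =
      ∏ j ∈ Finset.univ.erase i, (y j - z j) ^ β j / (Nat.factorial (β j) : ℝ) := by
    refine Finset.prod_congr rfl fun j hj => ?_
    simp [Finset.ne_of_mem_erase hj]
  have hi : (β + Pi.single i 1 : Fin n → ℕ) i = β i + 1 := by simp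
  rw [hprod, hi, h0]
  have h1 : HasDerivAt (fun t : ℝ => (y i - z i - t) ^ (β i + 1))
      (((β i + 1 : ℕ) : ℝ) * (y i - z i - 0) ^ (β i) * (-1)) 0 := by
    exact (((hasDerivAt_id (0 : ℝ)).const_sub (y i - z i)).pow (β i + 1)).congr_deriv (by simp)
  refine ((h1.div_const _).mul_const _).congr_deriv ?_
  rw [Nat.factorial_succ]
  have : (Nat.factorial (β i) : ℝ) ≠ 0 := by positivity
  push_cast
  field_simp
  ring

lemma sum_piAntidiag_succ_eq {i : Fin n} {j : ℕ} (F : (Fin n → ℕ) → ℝ)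
    (hF : ∀ β, β i = 0 → F β = 0) :
    ∑ β ∈ Finset.piAntidiag Finset.univ (j + 1), F β =
      ∑ β ∈ Finset.piAntidiag Finset.univ j, F (β + Pi.single i 1) := by
  symm
  refine Finset.sum_of_injOn (fun β => β + Pi.single i 1) (add_left_injective _).injOn ?_ ?_
    fun _ _ => rfl
  · intro β hβ
    have : ∑ l, β l = j := by simpa using hβ
    simp [Finset.sum_add_distrib, this]
  · intro β hβ hn
    refine hF β ?_
    by_contra hi
    refine hn ⟨β - Pi.single i 1, ?_, ?_⟩
    · have hle : Pi.single i 1 ≤ β := by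
        intro l
        by_cases hl : l = i
        · subst hl
          simpa using Nat.one_le_iff_ne_zero.2 hi
        · simp [hl]
      have h1 : ∑ l, β l = j + 1 := by simpa using hβ
      have h2 : ∑ l, ((β - Pi.single i 1 : Fin n → ℕ) l + (Pi.single i 1 : Fin n → ℕ) l) = j + 1 := by
        rw [← h1]
        exact Finset.sum_congr rfl fun l _ => Nat.sub_add_cancel (hle l)
      rw [Finset.sum_add_distrib, Finset.sum_pi_single'] at h2
      simp at h2 ⊢
      exact h2
    · funext l
      by_cases hl : l = i
      · subst hl
        simpa using Nat.sub_add_cancel (Nat.one_le_iff_ne_zero.2 hi)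
      · simp [hl]

/-- The Taylor polynomial of degree `k` at `z`, evaluated at `y`, of the function with
derivatives `F`. -/
noncomputable def taylorSum (F : (Fin n → ℕ) → EuclideanSpace ℝ (Fin n) → ℝ)
    (y : EuclideanSpace ℝ (Fin n)) (k : ℕ) (z : EuclideanSpace ℝ (Fin n)) : ℝ :=
  ∑ j ∈ Finset.range (k + 1), ∑ β ∈ Finset.piAntidiag Finset.univ j, F β z * taylorMonomial y β z

/-- The `i`-th derivative of `taylorSum F y k` in the base point. -/
noncomputable def taylorSumDeriv (F : (Fin n → ℕ) → EuclideanSpace ℝ (Fin n) → ℝ)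
    (y : EuclideanSpace ℝ (Fin n)) (k : ℕ) (i : Fin n) (z : EuclideanSpace ℝ (Fin n)) : ℝ :=
  ∑ β ∈ Finset.piAntidiag Finset.univ k, F (β + Pi.single i 1) z * taylorMonomial y β z

lemma taylorSumDeriv_eq (F : (Fin n → ℕ) → EuclideanSpace ℝ (Fin n) → ℝ)
    (y : EuclideanSpace ℝ (Fin n)) (k : ℕ) (i : Fin n) (z : EuclideanSpace ℝ (Fin n)) :
    taylorSumDeriv F y k i z =
      ∑ j ∈ Finset.range (k + 1), ∑ β ∈ Finset.piAntidiag Finset.univ j,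
        (F (β + Pi.single i 1) z * taylorMonomial y β z +
          F β z * fderiv ℝ (taylorMonomial y β) z (EuclideanSpace.single i 1)) := by
  induction k with
  | zero =>
    simp only [zero_add, Finset.range_one, Finset.sum_singleton, taylorSumDeriv]
    refine Finset.sum_congr rfl fun β hβ => ?_
    have : β = 0 := by simpa using hβ
    rw [fderiv_taylorMonomial_of_eq_zero y z (by simp [this]), mul_zero, add_zero]
  | succ k ih =>
    rw [Finset.sum_range_succ, ← ih, Finset.sum_add_distrib,
      sum_piAntidiag_succ_eq (i := i) (fun β => F β z * _)
        fun β hβ => by rw [fderiv_taylorMonomial_of_eq_zero y z hβ, mul_zero]]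
    simp only [fderiv_taylorMonomial_add_single, taylorSumDeriv, mul_neg, Finset.sum_neg_distrib]
    ring

section Family

variable {F : (Fin n → ℕ) → EuclideanSpace ℝ (Fin n) → ℝ} {k : ℕ}

lemma sum_add_single (β : Fin n → ℕ) (i : Fin n) :
    ∑ l, (β + Pi.single i 1 : Fin n → ℕ) l = ∑ l, β l + 1 := by
  simp [Finset.sum_add_distrib]

lemma locallyIntegrable_taylorSum (hF : ∀ β, ∑ l, β l ≤ k + 1 → LocallyIntegrable (F β))
    (y : EuclideanSpace ℝ (Fin n)) : LocallyIntegrable (taylorSum F y k) := by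
  refine locallyIntegrable_finsetSum (f := fun j z =>
    ∑ β ∈ Finset.piAntidiag Finset.univ j, F β z * taylorMonomial y β z) _ fun j hj => ?_
  refine locallyIntegrable_finsetSum (f := fun β z => F β z * taylorMonomial y β z) _
    fun β hβ => ?_
  have h1 : ∑ l, β l = j := by simpa using hβ
  have h2 := Finset.mem_range.1 hj
  exact LocallyIntegrable.mul_continuous (hF β (by omega)) (contDiff_taylorMonomial y β).continuous

lemma locallyIntegrable_taylorSumDeriv (hF : ∀ β, ∑ l, β l ≤ k + 1 → LocallyIntegrable (F β))
    (y : EuclideanSpace ℝ (Fin n)) (i : Fin n) : LocallyIntegrable (taylorSumDeriv F y k i) := by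
  refine locallyIntegrable_finsetSum
    (f := fun β z => F (β + Pi.single i 1) z * taylorMonomial y β z) _ fun β hβ => ?_
  have h1 : ∑ l, β l = k := by simpa using hβ
  exact LocallyIntegrable.mul_continuous (hF _ (by rw [sum_add_single, h1]))
    (contDiff_taylorMonomial y β).continuous

lemma hasWeakPartialDeriv_taylorSum (hF : ∀ β, ∑ l, β l ≤ k + 1 → LocallyIntegrable (F β))
    (hw : ∀ β i, ∑ l, β l ≤ k → HasWeakPartialDeriv (F β) (F (β + Pi.single i 1)) i)
    (y : EuclideanSpace ℝ (Fin n)) (i : Fin n) :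
    HasWeakPartialDeriv (taylorSum F y k) (taylorSumDeriv F y k i) i := by
  rw [funext (taylorSumDeriv_eq F y k i)]
  have hle : ∀ j ∈ Finset.range (k + 1), ∀ β ∈ Finset.piAntidiag (Finset.univ : Finset (Fin n)) j,
      ∑ l, β l ≤ k := by
    intro j hj β hβ
    have h1 : ∑ l, β l = j := by simpa using hβ
    have h2 := Finset.mem_range.1 hj
    omega
  have hl : ∀ j ∈ Finset.range (k + 1), ∀ β ∈ Finset.piAntidiag Finset.univ j,
      LocallyIntegrable (fun z => F β z * taylorMonomial y β z) := fun j hj β hβ =>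
    LocallyIntegrable.mul_continuous (hF β ((hle j hj β hβ).trans (Nat.le_succ k)))
      (contDiff_taylorMonomial y β).continuous
  have hl' : ∀ j ∈ Finset.range (k + 1), ∀ β ∈ Finset.piAntidiag Finset.univ j,
      LocallyIntegrable (fun z => F (β + Pi.single i 1) z * taylorMonomial y β z +
          F β z * fderiv ℝ (taylorMonomial y β) z (EuclideanSpace.single i 1)) :=
    fun j hj β hβ =>
    (LocallyIntegrable.mul_continuous
      (hF _ (by rw [sum_add_single]; exact Nat.succ_le_succ (hle j hj β hβ)))
      (contDiff_taylorMonomial y β).continuous).add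
    (LocallyIntegrable.mul_continuous (hF β ((hle j hj β hβ).trans (Nat.le_succ k)))
      (((contDiff_taylorMonomial y β).continuous_fderiv (by simp)).clm_apply continuous_const))
  refine HasWeakPartialDeriv.finset_sum
    (f := fun j z => ∑ β ∈ Finset.piAntidiag Finset.univ j, F β z * taylorMonomial y β z)
    (fun j hj => ?_) (fun j hj => locallyIntegrable_finsetSum _ (hl j hj))
    (fun j hj => locallyIntegrable_finsetSum _ (hl' j hj))
  refine HasWeakPartialDeriv.finset_sum (f := fun β z => F β z * taylorMonomial y β z)
    (fun β hβ => ?_) (hl j hj) (hl' j hj)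
  have h1 := hle j hj β hβ
  exact (hw β i h1).mul_contDiff (hF β (h1.trans (Nat.le_succ k)))
    (hF _ (by rw [sum_add_single]; exact Nat.succ_le_succ h1)) (contDiff_taylorMonomial y β)

/-- Near a point where the averages of the top order derivatives are bounded, the averages of
the gradient of each lower order derivative are bounded. -/
lemma exists_lintegral_sum_enorm_le (hF : ∀ β, ∑ l, β l ≤ k + 1 → LocallyIntegrable (F β))
    (hw : ∀ β i, ∑ l, β l ≤ k → HasWeakPartialDeriv (F β) (F (β + Pi.single i 1)) i)
    {p : EuclideanSpace ℝ (Fin n)} {M : ℝ} (hM : 0 ≤ M)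
    (h : ∀ β, ∑ l, β l = k + 1 → ∀ r, 0 < r →
      ∫⁻ z in ball p r, ‖F β z‖ₑ ≤ ENNReal.ofReal M * volume (ball p r))
    {β : Fin n → ℕ} (hβ : ∑ l, β l ≤ k) :
    ∃ K, 0 ≤ K ∧ ∀ r, 0 < r → r ≤ 1 →
      ∫⁻ z in ball p r, ∑ i, ‖F (β + Pi.single i 1) z‖ₑ ≤
        ENNReal.ofReal K * volume (ball p r) := by
  have hsum : ∀ β : Fin n → ℕ, ∑ l, β l ≤ k → (∀ i : Fin n, ∃ K, 0 ≤ K ∧ ∀ r, 0 < r → r ≤ 1 →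
      ∫⁻ z in ball p r, ‖F (β + Pi.single i 1) z‖ₑ ≤ ENNReal.ofReal K * volume (ball p r)) →
      ∃ K, 0 ≤ K ∧ ∀ r, 0 < r → r ≤ 1 →
        ∫⁻ z in ball p r, ∑ i, ‖F (β + Pi.single i 1) z‖ₑ ≤
          ENNReal.ofReal K * volume (ball p r) := by
    intro β hβ hex
    choose K hK hKr using hex
    refine ⟨∑ i, K i, Finset.sum_nonneg fun i _ => hK i, fun r hr hr1 => ?_⟩
    rw [lintegral_finsetSum' _ fun i _ =>
      ((hF _ (by rw [sum_add_single]; omega)).aestronglyMeasurable.enorm).restrict,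
      ENNReal.ofReal_sum_of_nonneg fun i _ => hK i, Finset.sum_mul]
    exact Finset.sum_le_sum fun i _ => hKr i r hr hr1
  have hall : ∀ (d : ℕ) (β : Fin n → ℕ), ∑ l, β l + d = k + 1 → ∃ K, 0 ≤ K ∧ ∀ r, 0 < r → r ≤ 1 →
      ∫⁻ z in ball p r, ‖F β z‖ₑ ≤ ENNReal.ofReal K * volume (ball p r) := by
    intro d
    induction d with
    | zero => exact fun β hβ => ⟨M, hM, fun r hr _ => h β (by omega) r hr⟩
    | succ d ih =>
      intro β hβ
      obtain ⟨K, hK, hKr⟩ := hsum β (by omega) fun i => ih _ (by rw [sum_add_single]; omega)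
      exact exists_lintegral_enorm_le (hF β (by omega))
        (fun i => hF _ (by rw [sum_add_single]; omega)) (fun i => hw β i (by omega)) hK hKr
  exact hsum β hβ fun i => hall (k - ∑ l, β l) _ (by rw [sum_add_single]; omega)

lemma tendsto_setAverage_taylorSum (hF : ∀ β, ∑ l, β l ≤ k + 1 → LocallyIntegrable (F β))
    (hw : ∀ β i, ∑ l, β l ≤ k → HasWeakPartialDeriv (F β) (F (β + Pi.single i 1)) i)
    {p : EuclideanSpace ℝ (Fin n)} {M : ℝ} (hM : 0 ≤ M)
    (h : ∀ β, ∑ l, β l = k + 1 → ∀ r, 0 < r →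
      ∫⁻ z in ball p r, ‖F β z‖ₑ ≤ ENNReal.ofReal M * volume (ball p r))
    (y : EuclideanSpace ℝ (Fin n)) :
    Tendsto (fun r : ℝ => ⨍ z in ball p r, taylorSum F y k z) (nhdsWithin 0 (Set.Ioi 0))
      (nhds (taylorSum (fun β => rep (F β)) y k p)) := by
  have hle : ∀ j ∈ Finset.range (k + 1), ∀ β ∈ Finset.piAntidiag (Finset.univ : Finset (Fin n)) j,
      ∑ l, β l ≤ k := by
    intro j hj β hβ
    have h1 : ∑ l, β l = j := by simpa using hβ
    have h2 := Finset.mem_range.1 hj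
    omega
  have heq : ∀ r : ℝ, ⨍ z in ball p r, taylorSum F y k z =
      ∑ j ∈ Finset.range (k + 1), ∑ β ∈ Finset.piAntidiag Finset.univ j,
        ⨍ z in ball p r, F β z * taylorMonomial y β z := by
    intro r
    have hi : ∀ j ∈ Finset.range (k + 1), ∀ β ∈ Finset.piAntidiag Finset.univ j,
        IntegrableOn (fun z => F β z * taylorMonomial y β z) (ball p r) := fun j hj β hβ =>
      LocallyIntegrable.integrableOn_ball (LocallyIntegrable.mul_continuous
        (hF β ((hle j hj β hβ).trans (Nat.le_succ k))) (contDiff_taylorMonomial y β).continuous) _ _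
    simp only [setAverage_eq, taylorSum, smul_eq_mul]
    rw [integral_finsetSum _ fun j hj => integrable_finsetSum _ (hi j hj), Finset.mul_sum]
    refine Finset.sum_congr rfl fun j hj => ?_
    rw [integral_finsetSum _ (hi j hj), Finset.mul_sum]
  simp only [heq]
  refine tendsto_finsetSum _ fun j hj => tendsto_finsetSum _ fun β hβ => ?_
  have h1 := hle j hj β hβ
  obtain ⟨K, hK, hKr⟩ := exists_lintegral_sum_enorm_le hF hw hM h h1
  have hFi := fun i : Fin n => hF (β + Pi.single i 1) (by rw [sum_add_single]; omega)
  have hFβ := hF β (by omega)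
  obtain ⟨K', hK', hKr'⟩ := exists_lintegral_enorm_le hFβ hFi (fun i => hw β i h1) hK hKr
  exact tendsto_setAverage_mul hFβ (contDiff_taylorMonomial y β).continuous one_pos hK' hKr'
    (tendsto_setAverage_rep hFβ hFi (fun i => hw β i h1) one_pos hK hKr)

lemma taylorSum_self (y : EuclideanSpace ℝ (Fin n)) : taylorSum F y k y = F 0 y := by
  rw [taylorSum, Finset.sum_range_succ', Finset.sum_eq_zero, zero_add, Finset.piAntidiag_zero,
    Finset.sum_singleton, taylorMonomial_zero, mul_one]
  intro j _
  refine Finset.sum_eq_zero fun β hβ => ?_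
  rw [taylorMonomial_self, mul_zero]
  rintro rfl
  simp at hβ


lemma sum_enorm_taylorSumDeriv_le {y z : EuclideanSpace ℝ (Fin n)} {Γ : ℝ≥0∞} {ρ : ℝ}
    (hΓ : ∀ β, ∑ l, β l = k + 1 → ‖F β z‖ₑ ≤ Γ) (hz : ‖y - z‖ ≤ ρ) :
    ∑ i, ‖taylorSumDeriv F y k i z‖ₑ ≤
      ENNReal.ofReal (n * (Finset.piAntidiag (Finset.univ : Finset (Fin n)) k).card * ρ ^ k) * Γ := by
  have hρ : 0 ≤ ρ := (norm_nonneg _).trans hz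
  have h1 : ∀ i, ‖taylorSumDeriv F y k i z‖ₑ ≤
      (Finset.piAntidiag (Finset.univ : Finset (Fin n)) k).card • (ENNReal.ofReal (ρ ^ k) * Γ) := by
    intro i
    refine (enorm_sum_le _ _).trans (Finset.sum_le_card_nsmul _ _ _ fun β hβ => ?_)
    have hk : ∑ l, β l = k := by simpa using hβ
    rw [enorm_mul, mul_comm]
    gcongr
    · rw [← ofReal_norm, Real.norm_eq_abs]
      refine ENNReal.ofReal_le_ofReal ((abs_taylorMonomial_le y z β).trans ?_)
      rw [hk]
      gcongr
    · exact hΓ _ (by rw [sum_add_single, hk])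
  refine (Finset.sum_le_card_nsmul _ _ _ fun i _ => h1 i).trans (le_of_eq ?_)
  rw [ENNReal.ofReal_mul (by positivity), ENNReal.ofReal_mul (by positivity)]
  simp only [Finset.card_univ, Fintype.card_fin, nsmul_eq_mul, ENNReal.ofReal_natCast]
  ring

/-- The constant in the pointwise Taylor estimate with top order `k + 1`. -/
noncomputable def taylorConst (n k : ℕ) : ℝ :=
  12 * 4 ^ n * (n * (Finset.piAntidiag (Finset.univ : Finset (Fin n)) k).card * 3 ^ k)

lemma taylorConst_nonneg (n k : ℕ) : 0 ≤ taylorConst n k := by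
  unfold taylorConst
  positivity

/-- The pointwise Taylor estimate for a family of weak derivatives whose top order members are
dominated by a function with bounded averages over balls centered at `x` and `y`. -/
lemma abs_rep_sub_taylorSum_le (hF : ∀ β, ∑ l, β l ≤ k + 1 → LocallyIntegrable (F β))
    (hw : ∀ β i, ∑ l, β l ≤ k → HasWeakPartialDeriv (F β) (F (β + Pi.single i 1)) i)
    {Γ : EuclideanSpace ℝ (Fin n) → ℝ≥0∞} (hΓ : ∀ β, ∑ l, β l = k + 1 → ∀ z, ‖F β z‖ₑ ≤ Γ z)
    {x y : EuclideanSpace ℝ (Fin n)} (hxy : x ≠ y) {M N : ℝ} (hM : 0 ≤ M) (hN : 0 ≤ N)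
    (hx : ∀ r, 0 < r → ∫⁻ z in ball x r, Γ z ≤ ENNReal.ofReal M * volume (ball x r))
    (hy : ∀ r, 0 < r → ∫⁻ z in ball y r, Γ z ≤ ENNReal.ofReal N * volume (ball y r)) :
    |rep (F 0) y - taylorSum (fun β => rep (F β)) y k x| ≤
      taylorConst n k * ‖x - y‖ ^ (k + 1) * (M + N) := by
  set R := ‖x - y‖ with hR
  have hR0 : 0 < R := norm_pos_iff.2 (sub_ne_zero.2 hxy)
  have hGl := locallyIntegrable_taylorSum hF y
  have hGd := locallyIntegrable_taylorSumDeriv hF y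
  have hGw := hasWeakPartialDeriv_taylorSum hF hw y
  set A : ℝ := n * (Finset.piAntidiag (Finset.univ : Finset (Fin n)) k).card * (3 * R) ^ k with hA
  have hA0 : 0 ≤ A := by positivity
  have hgrad : ∀ {p : EuclideanSpace ℝ (Fin n)} {M r : ℝ}, 0 < r → dist y p + r ≤ 3 * R →
      ∫⁻ z in ball p r, Γ z ≤ ENNReal.ofReal M * volume (ball p r) →
      ∫⁻ z in ball p r, ∑ i, ‖taylorSumDeriv F y k i z‖ₑ ≤
        ENNReal.ofReal (A * M) * volume (ball p r) := by
    intro p M r hr hpr h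
    calc ∫⁻ z in ball p r, ∑ i, ‖taylorSumDeriv F y k i z‖ₑ
        ≤ ∫⁻ z in ball p r, ENNReal.ofReal A * Γ z := by
          refine setLIntegral_mono' measurableSet_ball fun z hz => ?_
          refine sum_enorm_taylorSumDeriv_le (fun β hβ => hΓ β hβ z) ?_
          rw [← dist_eq_norm]
          have := dist_triangle_right y z p
          have := mem_ball.1 hz
          linarith
      _ = ENNReal.ofReal A * ∫⁻ z in ball p r, Γ z :=
          lintegral_const_mul' _ _ ENNReal.ofReal_ne_top
      _ ≤ _ := by
          rw [ENNReal.ofReal_mul hA0, mul_assoc]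
          gcongr
  have hyx : dist y x = R := by rw [dist_comm, dist_eq_norm]
  have hgx : ∀ r, 0 < r → r ≤ 2 * R →
      ∫⁻ z in ball x r, ∑ i, ‖taylorSumDeriv F y k i z‖ₑ ≤
        ENNReal.ofReal (A * M) * volume (ball x r) := fun r hr hr2 =>
    hgrad hr (by linarith) (hx r hr)
  have hgy : ∀ r, 0 < r → r ≤ R →
      ∫⁻ z in ball y r, ∑ i, ‖taylorSumDeriv F y k i z‖ₑ ≤
        ENNReal.ofReal (A * N) * volume (ball y r) := fun r hr hr2 =>
    hgrad hr (by rw [dist_self]; linarith) (hy r hr)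
  have htx := tendsto_setAverage_taylorSum hF hw hM
    (fun β hβ r hr => (lintegral_mono fun z => hΓ β hβ z).trans (hx r hr)) y
  have hty := tendsto_setAverage_taylorSum hF hw hN
    (fun β hβ r hr => (lintegral_mono fun z => hΓ β hβ z).trans (hy r hr)) y
  rw [taylorSum_self] at hty
  have h1 := abs_sub_setAverage_le_of_tendsto hGl hGd hGw (by positivity : 0 < 2 * R)
    (by positivity) hgx htx
  have h2 := abs_sub_setAverage_le_of_tendsto hGl hGd hGw hR0 (by positivity) hgy hty
  have h3 := abs_setAverage_sub_setAverage_le (a := y) (s := R) hGl hGd hGw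
    (by positivity : 0 < 2 * R) le_rfl (ball_subset_ball' (by rw [hyx]; linarith))
    (by positivity) (hgx _ (by positivity) le_rfl)
  have heq : taylorConst n k * R ^ (k + 1) * (M + N) =
      12 * 4 ^ n * R * (A * M) + 12 * 4 ^ n * R * (A * N) := by
    rw [taylorConst, hA, mul_pow]
    ring
  have hnn : 0 ≤ 4 ^ n * R * (A * N) := by positivity
  rw [heq]
  rw [abs_le] at h1 h2 h3 ⊢
  constructor <;> linarith

end Family

lemma tsum_subtype_eq_sum_range_piAntidiag (k : ℕ) (f : (Fin n → ℕ) → ℝ) :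
    ∑' β : {β : Fin n → ℕ // ∑ j, β j ≤ k}, f β.1 =
      ∑ j ∈ Finset.range (k + 1), ∑ β ∈ Finset.piAntidiag Finset.univ j, f β := by
  classical
  have hdisj : ((Finset.range (k + 1) : Finset ℕ) : Set ℕ).PairwiseDisjoint
      (Finset.piAntidiag (Finset.univ : Finset (Fin n))) := by
    intro a _ b _ hab
    refine Finset.disjoint_left.2 fun β ha hb => hab ?_
    simp at ha hb
    omega
  rw [← Finset.sum_biUnion hdisj, ← Finset.tsum_subtype]
  have hmem : ∀ β : Fin n → ℕ, ∑ j, β j ≤ k ↔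
      β ∈ (Finset.range (k + 1)).biUnion (Finset.piAntidiag (Finset.univ : Finset (Fin n))) := by
    intro β
    simp
  exact (Equiv.subtypeEquivRight hmem).tsum_eq (fun β => f β.1)

lemma enorm_le_enorm_gradmNorm {m : ℕ} (D : (Fin n → ℕ) → EuclideanSpace ℝ (Fin n) → ℝ)
    {α : Fin n → ℕ} (hα : ∑ j, α j = m) (z : EuclideanSpace ℝ (Fin n)) :
    ‖D α z‖ₑ ≤ ‖gradmNorm m D z‖ₑ := by
  have hfin : Finite {α : Fin n → ℕ // ∑ j, α j = m} :=
    Finite.of_injective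
      (fun α => (⟨α.1, by simpa using α.2⟩ :
        Finset.piAntidiag (Finset.univ : Finset (Fin n)) m))
      fun a b hab => Subtype.ext (congrArg (fun c => c.1) hab)
  have hle : D α z ^ 2 ≤ ∑' α : {α : Fin n → ℕ // ∑ j, α j = m}, D α.1 z ^ 2 :=
    (Summable.of_finite (f := fun α : {α : Fin n → ℕ // ∑ j, α j = m} => D α.1 z ^ 2)).le_tsum
      ⟨α, hα⟩ fun _ _ => sq_nonneg _
  rw [← ofReal_norm, ← ofReal_norm]
  refine ENNReal.ofReal_le_ofReal ?_
  rw [Real.norm_eq_abs, gradmNorm, Real.norm_of_nonneg (Real.sqrt_nonneg _)]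
  exact Real.abs_le_sqrt hle

lemma lintegral_enorm_le_maxFn {f : EuclideanSpace ℝ (Fin n) → ℝ}
    (x : EuclideanSpace ℝ (Fin n)) {r : ℝ} (hr : 0 < r) :
    ∫⁻ z in ball x r, ‖f z‖ₑ ≤ maxFn f x * volume (ball x r) := by
  have h : (volume (ball x r))⁻¹ * ∫⁻ z in ball x r, ‖f z‖ₑ ≤ maxFn f x :=
    le_iSup₂ (f := fun (r : ℝ) (_ : 0 < r) =>
      (volume (ball x r))⁻¹ * ∫⁻ z in ball x r, ‖f z‖₊) r hr
  calc ∫⁻ z in ball x r, ‖f z‖ₑ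
      = (volume (ball x r))⁻¹ * (∫⁻ z in ball x r, ‖f z‖ₑ) * volume (ball x r) := by
        rw [mul_right_comm, ENNReal.inv_mul_cancel (measure_ball_pos _ _ hr).ne'
          measure_ball_lt_top.ne, one_mul]
    _ ≤ _ := by gcongr

end Taylor

/-- Pointwise Taylor-remainder estimates for all the derivatives `D^α u`, `|α| ≤ m-1`:
`|D^α u(y) - T_x^{m-1-|α|}D^α u(y)| ≤ C |x - y|^{m-|α|} (ℳ|∇^m u|(x) + ℳ|∇^m u|(y))`,
where all derivatives are the precise (limsup of averages) representatives and the
maximal functions take values in `ℝ≥0∞`. -/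
theorem pointwise_taylor_estimate_derivs (n m : ℕ) (hn : 0 < n) (hm : 0 < m) :
    ∃ C : ℝ, 0 < C ∧
      ∀ (u : EuclideanSpace ℝ (Fin n) → ℝ)
        (D : (Fin n → ℕ) → EuclideanSpace ℝ (Fin n) → ℝ),
        WeakDerivFamily m u D →
        (∀ α : Fin n → ℕ, (∑ j, α j) ≤ m → LocallyIntegrable (D α) volume) →
        ∀ x y : EuclideanSpace ℝ (Fin n), x ≠ y →
          ∀ α : Fin n → ℕ, (∑ j, α j) ≤ m - 1 →
            ENNReal.ofReal
                |rep (D α) y -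
                  ∑' β : {β : Fin n → ℕ // (∑ j, β j) ≤ m - 1 - (∑ j, α j)},
                    rep (D (α + β.1)) x * (∏ i, (y i - x i) ^ (β.1 i))
                      / ∏ i, (Nat.factorial (β.1 i) : ℝ)|
              ≤ ENNReal.ofReal C * ENNReal.ofReal (‖x - y‖ ^ (m - ∑ j, α j)) *
                (maxFn (gradmNorm m D) x + maxFn (gradmNorm m D) y) := by
  refine ⟨1 + ∑ k ∈ Finset.range m, taylorConst n k,
    add_pos_of_pos_of_nonneg one_pos (Finset.sum_nonneg fun k _ => taylorConst_nonneg n k), ?_⟩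
  intro u D hD hloc x y hxy α hα
  set C := 1 + ∑ k ∈ Finset.range m, taylorConst n k with hC
  have hC1 : 1 ≤ C :=
    le_add_of_nonneg_right (Finset.sum_nonneg fun k _ => taylorConst_nonneg n k)
  have hR0 : 0 < ‖x - y‖ := norm_pos_iff.2 (sub_ne_zero.2 hxy)
  have hcoef : ENNReal.ofReal C * ENNReal.ofReal (‖x - y‖ ^ (m - ∑ j, α j)) ≠ 0 := by
    refine mul_ne_zero ?_ ?_ <;> rw [Ne, ENNReal.ofReal_eq_zero, not_le]
    · linarith
    · positivity
  by_cases htop : maxFn (gradmNorm m D) x + maxFn (gradmNorm m D) y = ∞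
  · rw [htop, ENNReal.mul_top hcoef]
    exact le_top
  obtain ⟨hxt, hyt⟩ := ENNReal.add_ne_top.1 htop
  obtain ⟨k, hk⟩ : ∃ k, k = m - 1 - ∑ j, α j := ⟨_, rfl⟩
  have hkm : m - ∑ j, α j = k + 1 := by omega
  have hsum : ∀ β : Fin n → ℕ, ∑ j, (α + β) j = ∑ j, α j + ∑ j, β j := fun β => by
    simp [Finset.sum_add_distrib]
  have key := abs_rep_sub_taylorSum_le (F := fun β => D (α + β)) (k := k)
    (Γ := fun z => ‖gradmNorm m D z‖ₑ)
    (fun β hβ => hloc _ (by rw [hsum]; omega))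
    (fun β i hβ => by
      rw [← add_assoc]
      exact hD.2 _ i (by rw [hsum]; omega))
    (fun β hβ z => enorm_le_enorm_gradmNorm D (by rw [hsum]; omega) z) hxy
    (M := (maxFn (gradmNorm m D) x).toReal) (N := (maxFn (gradmNorm m D) y).toReal)
    ENNReal.toReal_nonneg ENNReal.toReal_nonneg
    (fun r hr => by rw [ENNReal.ofReal_toReal hxt]; exact lintegral_enorm_le_maxFn x hr)
    (fun r hr => by rw [ENNReal.ofReal_toReal hyt]; exact lintegral_enorm_le_maxFn y hr)
  have htaylor : ∑' β : {β : Fin n → ℕ // (∑ j, β j) ≤ m - 1 - (∑ j, α j)},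
      rep (D (α + β.1)) x * (∏ i, (y i - x i) ^ (β.1 i)) / ∏ i, (Nat.factorial (β.1 i) : ℝ) =
      taylorSum (fun β => rep (D (α + β))) y k x := by
    rw [← hk, taylorSum, ← tsum_subtype_eq_sum_range_piAntidiag k
      fun β => rep (D (α + β)) x * taylorMonomial y β x]
    simp only [taylorMonomial, Finset.prod_div_distrib, mul_div_assoc]
  rw [htaylor, hkm]
  simp only [add_zero] at key
  have hCk : taylorConst n k ≤ C := by
    have := Finset.single_le_sum (f := taylorConst n) (fun j _ => taylorConst_nonneg n j)
      (Finset.mem_range.2 (by omega : k < m))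
    linarith
  calc _ ≤ ENNReal.ofReal (C * ‖x - y‖ ^ (k + 1) *
        ((maxFn (gradmNorm m D) x).toReal + (maxFn (gradmNorm m D) y).toReal)) := by
        refine ENNReal.ofReal_le_ofReal (key.trans ?_)
        gcongr
    _ = _ := by
        rw [ENNReal.ofReal_mul (by positivity), ENNReal.ofReal_mul (by positivity),
          ENNReal.ofReal_add ENNReal.toReal_nonneg ENNReal.toReal_nonneg,
          ENNReal.ofReal_toReal hxt, ENNReal.ofReal_toReal hyt]
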